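/- Assume the design is orthonormal, i.e., XᵀX = I_p, fix λ > 0 and γ ≥ 0, and for y ∈ ℝ^n let β̂ridge(y) = Xᵀy/(1+γ) (the ridge estimator with parameter γ under orthonormal design) and let β̂(y) be the unique minimizer of the coop-Lasso objective with response y, with fitted values ŷ(y) = Xβ̂(y). Then at every y ∈ ℝ^n such that all entries of Xᵀy are nonzero and ‖φ_j((Xᵀy)_{G_k})‖ ≠ λ w_k for all k and all j ∈ G_k, the map y ↦ ŷ(y) is differentiable and its divergence satisfies Σ_{i=1}^n ∂ŷ_i/∂y_i = Σ_{k=1}^K [ 1{‖(β̂(y)_{G_k})⁺‖ > 0}·(1 + ((p_+^k − 1)/(1+γ))·‖(β̂(y)_{G_k})⁺‖/‖(β̂ridge(y)_{G_k})⁺‖) + 1{‖(β̂(y)_{G_k})⁻‖ > 0}·(1 + ((p_−^k − 1)/(1+γ))·‖(β̂(y)_{G_k})⁻‖/‖(β̂ridge(y)_{G_k})⁻‖) ], where p_+^k and p_−^k are the numbers of positive and negative entries of β̂ridge(y)_{G_k}. -/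

import Mathlib

open scoped BigOperators

/-- Euclidean norm of the positive part of `v` restricted to the index set `G`. -/
noncomputable def enormP {α : Type*} (G : Finset α) (v : α → ℝ) : ℝ :=
  Real.sqrt (∑ j ∈ G, (max (v j) 0) ^ 2)

/-- Euclidean norm of the negative part of `v` restricted to the index set `G`. -/
noncomputable def enormN {α : Type*} (G : Finset α) (v : α → ℝ) : ℝ :=
  Real.sqrt (∑ j ∈ G, (max (-v j) 0) ^ 2)

/-- `‖φ_j(v_G)‖`: the Euclidean norm of `φ_j(v_G)`, where `φ_j(v) = 0` if `v j = 0`,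
`φ_j(v) = v⁺` if `v j > 0` and `φ_j(v) = v⁻` if `v j < 0`. -/
noncomputable def phiNorm {α : Type*} (G : Finset α) (v : α → ℝ) (j : α) : ℝ :=
  if 0 < v j then enormP G v else if v j < 0 then enormN G v else 0

/-- The cooperative-Lasso norm associated with groups `G k` and weights `w k`. -/
noncomputable def coopNorm {p K : ℕ} (G : Fin K → Finset (Fin p)) (w : Fin K → ℝ)
    (v : Fin p → ℝ) : ℝ :=
  ∑ k, w k * (enormP (G k) v + enormN (G k) v)

/-- The coop-Lasso objective `L(β) = (1/2)‖y − Xβ‖² + λ‖β‖_coop`. -/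
noncomputable def coopObj {p K n : ℕ} (G : Fin K → Finset (Fin p)) (w : Fin K → ℝ)
    (X : Matrix (Fin n) (Fin p) ℝ) (y : Fin n → ℝ) (lam : ℝ) (β : Fin p → ℝ) : ℝ :=
  (1 / 2) * (∑ i, (y i - Matrix.mulVec X β i) ^ 2) + lam * coopNorm G w β


namespace CoopAux

lemma enormN_eq {α : Type*} (G : Finset α) (v : α → ℝ) : enormN G v = enormP G (-v) := rfl

lemma enormP_nonneg {α : Type*} (G : Finset α) (v : α → ℝ) : 0 ≤ enormP G v := Real.sqrt_nonneg _

lemma enormP_sq {α : Type*} (G : Finset α) (v : α → ℝ) :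
    enormP G v ^ 2 = ∑ j ∈ G, (max (v j) 0) ^ 2 :=
  Real.sq_sqrt (Finset.sum_nonneg fun _ _ => sq_nonneg _)

lemma enormP_congr {α : Type*} (G : Finset α) (u v : α → ℝ) (h : ∀ j ∈ G, u j = v j) :
    enormP G u = enormP G v := by
  unfold enormP
  rw [Finset.sum_congr rfl fun j hj => by rw [h j hj]]

/-- If the positive part of `u` is `c` times that of `v`, so are the norms. -/
lemma enormP_scale {α : Type*} (G : Finset α) (u v : α → ℝ) (c : ℝ) (hc : 0 ≤ c)
    (h : ∀ j ∈ G, max (u j) 0 = c * max (v j) 0) :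
    enormP G u = c * enormP G v := by
  have h1 : ∑ j ∈ G, (max (u j) 0) ^ 2 = c ^ 2 * ∑ j ∈ G, (max (v j) 0) ^ 2 := by
    rw [Finset.mul_sum]
    exact Finset.sum_congr rfl fun j hj => by rw [h j hj]; ring
  unfold enormP
  rw [h1, Real.sqrt_mul (sq_nonneg c), Real.sqrt_sq hc]

/-- shrinkage factor -/
noncomputable def fac {α : Type*} (G : Finset α) (t : ℝ) (b : α → ℝ) : ℝ :=
  if enormP G b ≤ t then 0 else 1 - t / enormP G b

lemma fac_nonneg {α : Type*} (G : Finset α) (t : ℝ) (ht : 0 < t) (b : α → ℝ) :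
    0 ≤ fac G t b := by
  unfold fac
  split_ifs with h
  · exact le_rfl
  · push Not at h
    have : t / enormP G b ≤ 1 := (div_le_one (ht.trans h)).2 h.le
    linarith

lemma fac_le {α : Type*} (G : Finset α) (t : ℝ) (ht : 0 < t) (b : α → ℝ) :
    fac G t b ≤ 1 := by
  unfold fac
  split_ifs with h
  · exact zero_le_one
  · push Not at h
    have : 0 ≤ t / enormP G b := div_nonneg ht.le (ht.trans h).le
    linarith

lemma fac_bound {α : Type*} (G : Finset α) (t : ℝ) (ht : 0 < t) (b : α → ℝ) :
    (1 - fac G t b) * enormP G b ≤ t := by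
  unfold fac
  split_ifs with h
  · linarith
  · push Not at h
    have : enormP G b ≠ 0 := (ht.trans h).ne'
    apply le_of_eq
    field_simp
    ring

lemma fac_eq {α : Type*} (G : Finset α) (t : ℝ) (ht : 0 < t) (b : α → ℝ) :
    fac G t b * ((1 - fac G t b) * enormP G b) = fac G t b * t := by
  unfold fac
  split_ifs with h
  · simp
  · push Not at h
    have : enormP G b ≠ 0 := (ht.trans h).ne'
    congr 1
    field_simp
    ring

noncomputable def shrP {α : Type*} (G : Finset α) (t : ℝ) (b : α → ℝ) (j : α) : ℝ :=
  fac G t b * max (b j) 0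

noncomputable def shr {α : Type*} (G : Finset α) (t : ℝ) (b : α → ℝ) (j : α) : ℝ :=
  shrP G t b j - shrP G t (-b) j

lemma shr_neg {α : Type*} (G : Finset α) (t : ℝ) (b : α → ℝ) :
    shr G t (-b) = - shr G t b := by
  funext j
  simp [shr]

lemma max_shr {α : Type*} (G : Finset α) (t : ℝ) (ht : 0 < t) (b : α → ℝ) (j : α) :
    max (shr G t b j) 0 = fac G t b * max (b j) 0 := by
  have h1 := fac_nonneg G t ht b
  have h2 := fac_nonneg G t ht (-b)
  unfold shr shrP
  rcases le_total (b j) 0 with h | h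
  · rw [max_eq_right h, max_eq_left (a := (-b) j) (by simpa using h)]
    rw [mul_zero]
    apply max_eq_right
    have : 0 ≤ (-b) j := by simpa using h
    nlinarith [mul_nonneg h2 this]
  · rw [max_eq_left h, max_eq_right (a := (-b) j) (by simpa using h)]
    rw [mul_zero, sub_zero]
    exact max_eq_left (mul_nonneg h1 h)

lemma enormP_shr {α : Type*} (G : Finset α) (t : ℝ) (ht : 0 < t) (b : α → ℝ) :
    enormP G (shr G t b) = fac G t b * enormP G b :=
  enormP_scale G _ _ _ (fac_nonneg G t ht b) fun j _ => max_shr G t ht b j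

lemma half_le {α : Type*} (G : Finset α) (t : ℝ) (ht : 0 < t) (b u : α → ℝ) :
    ∑ j ∈ G, ((1 - fac G t b) * max (b j) 0) * u j ≤ t * enormP G u := by
  have hf := fac_le G t ht b
  have h1 : ∑ j ∈ G, max (b j) 0 * max (u j) 0 ≤ enormP G b * enormP G u :=
    Real.sum_mul_le_sqrt_mul_sqrt G _ _
  calc ∑ j ∈ G, ((1 - fac G t b) * max (b j) 0) * u j
      ≤ ∑ j ∈ G, (1 - fac G t b) * (max (b j) 0 * max (u j) 0) := by
        apply Finset.sum_le_sum
        intro j _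
        rw [mul_assoc]
        apply mul_le_mul_of_nonneg_left _ (by linarith)
        exact mul_le_mul_of_nonneg_left (le_max_left _ _) (le_max_right _ _)
    _ = (1 - fac G t b) * ∑ j ∈ G, (max (b j) 0 * max (u j) 0) := by rw [Finset.mul_sum]
    _ ≤ (1 - fac G t b) * (enormP G b * enormP G u) :=
        mul_le_mul_of_nonneg_left h1 (by linarith)
    _ = ((1 - fac G t b) * enormP G b) * enormP G u := by ring
    _ ≤ t * enormP G u := mul_le_mul_of_nonneg_right (fac_bound G t ht b) (enormP_nonneg _ _)

lemma half_eq {α : Type*} (G : Finset α) (t : ℝ) (ht : 0 < t) (b : α → ℝ) :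
    ∑ j ∈ G, ((1 - fac G t b) * max (b j) 0) * shr G t b j = t * enormP G (shr G t b) := by
  have h1 : ∀ j ∈ G, ((1 - fac G t b) * max (b j) 0) * shr G t b j
      = (fac G t b * (1 - fac G t b)) * (max (b j) 0) ^ 2 := by
    intro j _
    unfold shr shrP
    rcases le_total (b j) 0 with h | h
    · rw [max_eq_right h]; ring
    · rw [max_eq_right (a := (-b) j) (by simpa using h)]; ring
  rw [Finset.sum_congr rfl h1, ← Finset.mul_sum, ← enormP_sq, enormP_shr G t ht]
  have := fac_eq G t ht b
  linear_combination enormP G b * this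

lemma resid {α : Type*} (G : Finset α) (t : ℝ) (b : α → ℝ) (j : α) :
    b j - shr G t b j = (1 - fac G t b) * max (b j) 0 - (1 - fac G t (-b)) * max ((-b) j) 0 := by
  unfold shr shrP
  rcases le_total (b j) 0 with h | h
  · rw [max_eq_right h, max_eq_left (a := (-b) j) (by simpa using h)]; simp; ring
  · rw [max_eq_left h, max_eq_right (a := (-b) j) (by simpa using h)]; ring

lemma group_split {α : Type*} (G : Finset α) (t : ℝ) (b u : α → ℝ) :
    ∑ j ∈ G, (b j - shr G t b j) * u j =
      ∑ j ∈ G, ((1 - fac G t b) * max (b j) 0) * u j +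
      ∑ j ∈ G, ((1 - fac G t (-b)) * max ((-b) j) 0) * (-u) j := by
  rw [← Finset.sum_add_distrib]
  refine Finset.sum_congr rfl fun j _ => ?_
  rw [resid]; simp only [Pi.neg_apply]; ring

lemma group_le {α : Type*} (G : Finset α) (t : ℝ) (ht : 0 < t) (b u : α → ℝ) :
    ∑ j ∈ G, (b j - shr G t b j) * u j ≤ t * (enormP G u + enormN G u) := by
  rw [group_split, enormN_eq, mul_add]
  exact add_le_add (half_le G t ht b u) (half_le G t ht (-b) (-u))

lemma group_eq {α : Type*} (G : Finset α) (t : ℝ) (ht : 0 < t) (b : α → ℝ) :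
    ∑ j ∈ G, (b j - shr G t b j) * shr G t b j
      = t * (enormP G (shr G t b) + enormN G (shr G t b)) := by
  rw [group_split, enormN_eq, mul_add, half_eq G t ht b, ← shr_neg, half_eq G t ht (-b)]

/-- Derivative of the positive half. -/
lemma shrP_deriv {p : ℕ} (G : Finset (Fin p)) (t : ℝ) (ht : 0 < t) (b : Fin p → ℝ)
    (hb : ∀ j, b j ≠ 0) (hP : enormP G b ≠ t) (j : Fin p) (hj : j ∈ G) :
    ∃ D : (Fin p → ℝ) →L[ℝ] ℝ, HasFDerivAt (fun b => shrP G t b j) D b ∧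
      D (Pi.single j 1) = if enormP G b ≤ t then 0 else
        (if 0 < b j then 1 - t / enormP G b else 0) + t * (max (b j) 0) ^ 2 / enormP G b ^ 3 := by
  have hcont : Continuous (fun b : Fin p → ℝ => enormP G b) := by
    unfold enormP; fun_prop
  rcases lt_or_gt_of_ne hP with h | h
  · refine ⟨0, ?_, by rw [if_pos h.le]; simp⟩
    refine (hasFDerivAt_const (0:ℝ) b).congr_of_eventuallyEq ?_
    filter_upwards [hcont.continuousAt.eventually_lt continuousAt_const h] with c hc
    simp [shrP, fac, hc.le]
  · have hP0 : enormP G b ≠ 0 := (ht.trans h).ne'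
    -- derivative of max
    obtain ⟨c, hcdef⟩ : ∃ c : Fin p → ℝ, ∀ l, c l = if 0 < b l then (1:ℝ) else 0 := ⟨_, fun _ => rfl⟩
    have hmax : ∀ l, HasFDerivAt (fun b : Fin p → ℝ => max (b l) 0)
        (c l • (ContinuousLinearMap.proj l : (Fin p → ℝ) →L[ℝ] ℝ)) b := by
      intro l
      have hpr : HasFDerivAt (fun b : Fin p → ℝ => b l)
        (ContinuousLinearMap.proj l : (Fin p → ℝ) →L[ℝ] ℝ) b :=
        (ContinuousLinearMap.proj (R := ℝ) (φ := fun _ : Fin p => ℝ) l).hasFDerivAt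
      have hc : Continuous (fun b : Fin p → ℝ => b l) := continuous_apply l
      rcases lt_or_gt_of_ne (hb l) with hl | hl
      · rw [hcdef, if_neg hl.not_gt, zero_smul]
        refine (hasFDerivAt_const (0:ℝ) b).congr_of_eventuallyEq ?_
        filter_upwards [hc.continuousAt.eventually_lt continuousAt_const hl] with c hc
        exact max_eq_right hc.le
      · rw [hcdef, if_pos hl, one_smul]
        refine hpr.congr_of_eventuallyEq ?_
        filter_upwards [continuousAt_const.eventually_lt hc.continuousAt hl] with c hc
        exact max_eq_left hc.le
    have hsum := HasFDerivAt.fun_sum (u := G) fun l _ => (hmax l).pow 2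
    have hpos : ∑ l ∈ G, (max (b l) 0) ^ 2 ≠ 0 := by
      rw [← enormP_sq]; exact pow_ne_zero 2 hP0
    have hsq := hsum.sqrt hpos
    have hinv := ((hasDerivAt_inv hP0).comp_hasFDerivAt b hsq)
    have hfin := ((hinv.const_mul t).const_sub 1).mul (hmax j)
    refine ⟨_, hfin.congr_of_eventuallyEq ?_, ?_⟩
    · filter_upwards [continuousAt_const.eventually_lt hcont.continuousAt h] with c hc
      simp only [shrP, fac, hc.not_ge, if_false]
      rfl
    · rw [if_neg h.not_ge]
      have e1 : ∑ l ∈ G, (2 * max (b l) 0) * (c l *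
          (Pi.single j (1:ℝ) : Fin p → ℝ) l) = 2 * max (b j) 0 := by
        rw [Finset.sum_eq_single_of_mem j hj]
        · rcases lt_or_gt_of_ne (hb j) with hl | hl
          · simp [hl.le]
          · simp [hcdef, hl]
        · intro l _ hl
          simp [hl]
      have e2 : √(∑ l ∈ G, (max (b l) 0) ^ 2) = enormP G b := rfl
      have e3 : (if 0 < b j then 1 - t / enormP G b else 0) = (1 - t / enormP G b) * c j := by
        rw [hcdef]; split_ifs <;> simp
      rw [e3]
      simp [e2, -smul_eq_mul, -Finset.sum_apply]
      simp only [smul_eq_mul, e1]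
      field_simp

lemma shr_deriv {p : ℕ} (G : Finset (Fin p)) (t : ℝ) (ht : 0 < t) (b : Fin p → ℝ)
    (hb : ∀ j, b j ≠ 0) (hP : enormP G b ≠ t) (hN : enormP G (-b) ≠ t) (j : Fin p) (hj : j ∈ G) :
    ∃ D : (Fin p → ℝ) →L[ℝ] ℝ, HasFDerivAt (fun b => shr G t b j) D b ∧
      D (Pi.single j 1) = (if enormP G b ≤ t then 0 else
        (if 0 < b j then 1 - t / enormP G b else 0) + t * (max (b j) 0) ^ 2 / enormP G b ^ 3) +
        (if enormP G (-b) ≤ t then 0 else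
        (if 0 < (-b) j then 1 - t / enormP G (-b) else 0) +
          t * (max ((-b) j) 0) ^ 2 / enormP G (-b) ^ 3) := by
  obtain ⟨D1, h1, e1⟩ := shrP_deriv G t ht b hb hP j hj
  obtain ⟨D2, h2, e2⟩ := shrP_deriv G t ht (-b) (fun j => by simpa using hb j) hN j hj
  have h3 := h2.comp b (hasFDerivAt_id b).neg
  refine ⟨_, h1.sub h3, ?_⟩
  rw [← e1, ← e2]
  simp

/-- Sum over a group of one half of the diagonal derivative. -/
lemma half_trace {p : ℕ} (G : Finset (Fin p)) (t γ : ℝ) (ht : 0 < t) (hγ : 0 ≤ γ) (b r β : Fin p → ℝ)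
    (hr : ∀ j, r j = b j / (1 + γ)) (hβ : ∀ j ∈ G, β j = shr G t b j) :
    ∑ j ∈ G, (if enormP G b ≤ t then 0 else
        (if 0 < b j then 1 - t / enormP G b else 0) + t * (max (b j) 0) ^ 2 / enormP G b ^ 3) =
    if 0 < enormP G β then
            1 + (((G.filter fun j => 0 < r j).card : ℝ) - 1) / (1 + γ) *
              (enormP G β / enormP G r)
          else 0 := by
  have hγ' : 0 < 1 + γ := by linarith
  rw [enormP_congr G _ _ hβ, enormP_shr G t ht]
  have hr' : enormP G r = (1 + γ)⁻¹ * enormP G b := by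
    apply enormP_scale _ _ _ _ (by positivity)
    intro j _
    rw [hr, mul_max_of_nonneg _ _ (by positivity), mul_zero, div_eq_inv_mul]
  have hcard : (G.filter fun j => 0 < r j) = G.filter fun j => 0 < b j := by
    refine Finset.filter_congr fun j _ => ?_
    rw [hr]; exact div_pos_iff_of_pos_right hγ'
  rw [hr', hcard]
  by_cases h : enormP G b ≤ t
  · simp [fac, h]
  · have h' := h
    push Not at h'
    have hP : 0 < enormP G b := ht.trans h'
    have hf : fac G t b = 1 - t / enormP G b := by simp [fac, h]
    have hf0 : 0 < 1 - t / enormP G b := by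
      have : t / enormP G b < 1 := (div_lt_one hP).2 h'
      linarith
    rw [hf, if_pos (mul_pos hf0 hP)]
    simp only [h, if_false]
    rw [Finset.sum_add_distrib, ← Finset.sum_div, ← Finset.mul_sum, ← enormP_sq,
      ← Finset.sum_filter, Finset.sum_const, nsmul_eq_mul]
    field_simp
    ring

lemma sum_groups {p K : ℕ} (G : Fin K → Finset (Fin p))
    (hcover : ∀ j : Fin p, ∃ k, j ∈ G k)
    (hdisj : ∀ k l : Fin K, k ≠ l → Disjoint (G k) (G l)) (f : Fin p → ℝ) :
    ∑ j, f j = ∑ k, ∑ j ∈ G k, f j := by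
  rw [← Finset.sum_biUnion (fun k _ l _ h => hdisj k l h)]
  congr 1
  ext j
  simpa using hcover j

lemma ssq {p n : ℕ} (X : Matrix (Fin n) (Fin p) ℝ) (hX : X.transpose * X = 1)
    (z : Fin n → ℝ) (u : Fin p → ℝ) :
    ∑ i, (z i - Matrix.mulVec X u i) ^ 2 =
      ∑ i, z i ^ 2 - 2 * ∑ j, (∑ i, X i j * z i) * u j + ∑ j, u j ^ 2 := by
  have h1 : (X.mulVec u) ⬝ᵥ (X.mulVec u) = u ⬝ᵥ u := by
    rw [Matrix.dotProduct_mulVec, Matrix.vecMul_mulVec, hX, Matrix.vecMul_one]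
  have h2 : z ⬝ᵥ (X.mulVec u) = ∑ j, (∑ i, X i j * z i) * u j := by
    rw [Matrix.dotProduct_mulVec]
    simp only [dotProduct, Matrix.vecMul, mul_comm]
  rw [← h2]
  have h3 : ∑ j, u j ^ 2 = (X.mulVec u) ⬝ᵥ (X.mulVec u) := by
    rw [h1]; simp [dotProduct, sq]
  rw [h3]
  simp only [dotProduct, Finset.mul_sum]
  rw [← Finset.sum_sub_distrib, ← Finset.sum_add_distrib]
  exact Finset.sum_congr rfl fun i _ => by ring

end CoopAux

open CoopAux

/-- degrees of freedom of the coop-Lasso fit under orthonormal design.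
At every generic `y` (all entries of `Xᵀy` nonzero and no `φ`-norm equal to `λ w_k`),
the fitted-value map `y ↦ ŷ(y) = Xβ̂(y)` is differentiable and its divergence equals
the claimed group-wise expression involving the ridge estimator `β̂ridge = Xᵀy/(1+γ)`. -/
theorem coopLasso_degrees_of_freedom (p K n : ℕ) (hp : 1 ≤ p) (hpn : p ≤ n)
    (G : Fin K → Finset (Fin p))
    (hcover : ∀ j : Fin p, ∃ k, j ∈ G k)
    (hdisj : ∀ k l : Fin K, k ≠ l → Disjoint (G k) (G l))
    (w : Fin K → ℝ) (hw : ∀ k, 0 < w k)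
    (X : Matrix (Fin n) (Fin p) ℝ)
    (hX : X.transpose * X = 1)
    (lam γ : ℝ) (hlam : 0 < lam) (hγ : 0 ≤ γ)
    (βhat : (Fin n → ℝ) → (Fin p → ℝ))
    (hmin : ∀ z : Fin n → ℝ, ∀ u : Fin p → ℝ,
      coopObj G w X z lam (βhat z) ≤ coopObj G w X z lam u)
    (y : Fin n → ℝ)
    (ridge : Fin p → ℝ) (hridge : ∀ j, ridge j = (∑ i, X i j * y i) / (1 + γ))
    (hgen1 : ∀ j, (∑ i, X i j * y i) ≠ 0)
    (hgen2 : ∀ k, ∀ j ∈ G k,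
      phiNorm (G k) (fun l => ∑ i, X i l * y i) j ≠ lam * w k) :
    DifferentiableAt ℝ (fun z : Fin n → ℝ => Matrix.mulVec X (βhat z)) y ∧
    (∑ i, fderiv ℝ (fun z : Fin n → ℝ => Matrix.mulVec X (βhat z)) y (Pi.single i 1) i) =
      ∑ k,
        ((if 0 < enormP (G k) (βhat y) then
            1 + ((((G k).filter fun j => 0 < ridge j).card : ℝ) - 1) / (1 + γ) *
              (enormP (G k) (βhat y) / enormP (G k) ridge)
          else 0) +
         (if 0 < enormN (G k) (βhat y) then
            1 + ((((G k).filter fun j => ridge j < 0).card : ℝ) - 1) / (1 + γ) *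
              (enormN (G k) (βhat y) / enormN (G k) ridge)
          else 0)) := by
  obtain ⟨κ, hκ⟩ := Classical.axiomOfChoice hcover
  have hκ' : ∀ k, ∀ j ∈ G k, κ j = k := by
    intro k j hj
    by_contra hne
    exact Finset.disjoint_left.1 (hdisj _ _ hne) (hκ j) hj
  set S : (Fin p → ℝ) → (Fin p → ℝ) :=
    fun b j => shr (G (κ j)) (lam * w (κ j)) b j with hS
  have ht : ∀ k, 0 < lam * w k := fun k => mul_pos hlam (hw k)
  have hSk : ∀ b k, ∀ j ∈ G k, S b j = shr (G k) (lam * w k) b j := by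
    intro b k j hj
    simp only [hS, hκ' k j hj]
  have hEN : ∀ b k, ∀ u : Fin p → ℝ, (∀ j ∈ G k, u j = shr (G k) (lam * w k) b j) →
      enormP (G k) u + enormN (G k) u = enormP (G k) (shr (G k) (lam * w k) b) +
        enormN (G k) (shr (G k) (lam * w k) b) := by
    intro b k u hu
    rw [enormN_eq, enormN_eq, enormP_congr _ _ _ hu]
    congr 1
    exact enormP_congr _ _ _ fun j hj => by simp [hu j hj]
  have hsub : ∀ b u, ∑ j, (b j - S b j) * u j ≤ lam * coopNorm G w u := by
    intro b u
    rw [sum_groups G hcover hdisj, coopNorm, Finset.mul_sum]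
    refine Finset.sum_le_sum fun k _ => ?_
    rw [← mul_assoc]
    refine le_trans (le_of_eq ?_) (group_le (G k) _ (ht k) b u)
    exact Finset.sum_congr rfl fun j hj => by rw [hSk b k j hj]
  have heq : ∀ b, ∑ j, (b j - S b j) * S b j = lam * coopNorm G w (S b) := by
    intro b
    rw [sum_groups G hcover hdisj, coopNorm, Finset.mul_sum]
    refine Finset.sum_congr rfl fun k _ => ?_
    rw [← mul_assoc, hEN b k _ (hSk b k), ← group_eq (G k) _ (ht k) b]
    exact Finset.sum_congr rfl fun j hj => by rw [hSk b k j hj]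
  have hβ : ∀ z, βhat z = S (X.transpose.mulVec z) := by
    intro z
    set b := X.transpose.mulVec z with hb
    have hbj : ∀ j, ∑ i, X i j * z i = b j := fun j => rfl
    have h := hmin z (S b)
    unfold coopObj at h
    rw [ssq X hX, ssq X hX] at h
    simp only [hbj] at h
    have h1 := hsub b (βhat z)
    have h2 := heq b
    have h3 : ∑ j, (βhat z j - S b j) ^ 2 = ∑ j, βhat z j ^ 2 - 2 * ∑ j, b j * βhat z j
        + 2 * ∑ j, (b j - S b j) * βhat z j - 2 * ∑ j, (b j - S b j) * S b j
        + 2 * ∑ j, b j * S b j - ∑ j, S b j ^ 2 := by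
      simp only [Finset.mul_sum]
      simp only [← Finset.sum_sub_distrib, ← Finset.sum_add_distrib]
      exact Finset.sum_congr rfl fun j _ => by ring
    have h4 : ∑ j, (βhat z j - S b j) ^ 2 ≤ 0 := by
      rw [h3]; linarith
    have h5 : ∑ j, (βhat z j - S b j) ^ 2 = 0 :=
      le_antisymm h4 (Finset.sum_nonneg fun _ _ => sq_nonneg _)
    rw [Finset.sum_eq_zero_iff_of_nonneg fun _ _ => sq_nonneg _] at h5
    funext j
    exact sub_eq_zero.1 (pow_eq_zero_iff (two_ne_zero) |>.1 (h5 j (Finset.mem_univ j)))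
  set b := X.transpose.mulVec y with hb
  have hbj : ∀ j, ∑ i, X i j * y i = b j := fun j => rfl
  simp only [hbj] at hridge hgen1 hgen2
  have hzero : ∀ k, ∀ v : Fin p → ℝ, (∀ j ∈ G k, v j ≤ 0) → enormP (G k) v = 0 := by
    intro k v hv
    unfold enormP
    rw [Finset.sum_eq_zero, Real.sqrt_zero]
    intro j hj
    rw [max_eq_right (hv j hj)]; norm_num
  have hP : ∀ k, enormP (G k) b ≠ lam * w k := by
    intro k
    by_cases h : ∃ j ∈ G k, 0 < b j
    · obtain ⟨j, hj, hj'⟩ := h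
      have := hgen2 k j hj
      simpa [phiNorm, hj'] using this
    · push Not at h
      rw [hzero k b h]; exact (ht k).ne
  have hN : ∀ k, enormP (G k) (-b) ≠ lam * w k := by
    intro k
    by_cases h : ∃ j ∈ G k, b j < 0
    · obtain ⟨j, hj, hj'⟩ := h
      have := hgen2 k j hj
      rw [← enormN_eq]
      simpa [phiNorm, hj', hj'.not_gt] using this
    · push Not at h
      rw [hzero k (-b) (fun j hj => by simpa using h j hj)]; exact (ht k).ne
  have hD := fun j => shr_deriv (G (κ j)) _ (ht (κ j)) b hgen1 (hP _) (hN _) j (hκ j)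
  choose D hD1 hD2 using hD
  have hSd : HasFDerivAt S (ContinuousLinearMap.pi D) b := hasFDerivAt_pi.2 hD1
  have hfun : (fun z : Fin n → ℝ => Matrix.mulVec X (βhat z)) =
      fun z => (Matrix.mulVecLin X).toContinuousLinearMap
        (S ((Matrix.mulVecLin X.transpose).toContinuousLinearMap z)) := by
    funext z
    rw [hβ]; rfl
  have hbe : (Matrix.mulVecLin X.transpose).toContinuousLinearMap y = b := rfl
  have hF := ((Matrix.mulVecLin X).toContinuousLinearMap.hasFDerivAt (x := S b)).comp y
    (HasFDerivAt.comp y (hbe ▸ hSd)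
      (Matrix.mulVecLin X.transpose).toContinuousLinearMap.hasFDerivAt)
  have hF' : HasFDerivAt (𝕜 := ℝ) (fun z : Fin n → ℝ => Matrix.mulVec X (βhat z))
      ((Matrix.mulVecLin X).toContinuousLinearMap.comp
      ((ContinuousLinearMap.pi D).comp
        (Matrix.mulVecLin X.transpose).toContinuousLinearMap)) y := by
    rw [hfun]; exact hF
  refine ⟨hF'.differentiableAt, ?_⟩
  rw [hF'.fderiv]
  have htr : ∀ A : Matrix (Fin p) (Fin p) ℝ, (X * A * X.transpose).trace = A.trace := by
    intro A
    rw [Matrix.trace_mul_comm, ← Matrix.mul_assoc, hX, Matrix.one_mul]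
  have key : ∑ i, (((Matrix.mulVecLin X).toContinuousLinearMap.comp
      ((ContinuousLinearMap.pi D).comp
        (Matrix.mulVecLin X.transpose).toContinuousLinearMap)) (Pi.single i 1)) i
      = ∑ j, D j (Pi.single j 1) := by
    set A : Matrix (Fin p) (Fin p) ℝ :=
      LinearMap.toMatrix' (ContinuousLinearMap.pi D : (Fin p → ℝ) →L[ℝ] (Fin p → ℝ)).toLinearMap with hA
    have hAv : ∀ v, ContinuousLinearMap.pi D v = A.mulVec v := by
      intro v
      rw [hA, LinearMap.toMatrix'_mulVec]; rfl
    have h1 := htr A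
    have h2 : A.trace = ∑ j, D j (Pi.single j 1) := by
      simp only [Matrix.trace, Matrix.diag]
      refine Finset.sum_congr rfl fun j _ => ?_
      rw [hA, LinearMap.toMatrix'_apply]
      simp
    rw [← h2, ← h1]
    simp only [Matrix.trace, Matrix.diag]
    refine Finset.sum_congr rfl fun i _ => ?_
    simp only [ContinuousLinearMap.comp_apply, hAv]
    change (X.mulVec (A.mulVec (X.transpose.mulVec (Pi.single i 1)))) i = _
    rw [Matrix.mulVec_mulVec, Matrix.mulVec_mulVec, Matrix.mulVec_single_one]
    simp [Matrix.col, Matrix.mul_assoc]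
  refine key.trans ?_
  rw [sum_groups G hcover hdisj]
  refine Finset.sum_congr rfl fun k _ => ?_
  have hβy : ∀ j ∈ G k, βhat y j = shr (G k) (lam * w k) b j := by
    intro j hj
    rw [hβ]; exact hSk b k j hj
  have hsumk : ∀ j ∈ G k, D j (Pi.single j 1) = _ := fun j hj => by
    rw [hD2 j, hκ' k j hj]
  rw [Finset.sum_congr rfl hsumk, Finset.sum_add_distrib,
    half_trace (G k) _ γ (ht k) hγ b ridge (βhat y) hridge hβy,
    half_trace (G k) _ γ (ht k) hγ (-b) (-ridge) (-βhat y)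
      (fun j => by simp only [Pi.neg_apply, hridge]; ring)
      (fun j hj => by rw [shr_neg]; simp [hβy j hj])]
  have hcard : ((G k).filter fun j => 0 < (-ridge) j) = (G k).filter fun j => ridge j < 0 :=
    Finset.filter_congr fun j _ => by simp
  rw [hcard]
  rfl
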